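/- Let T be a tree (a connected, acyclic simple graph) and let g and h be graph automorphisms of T, neither of which inverts an edge (there is no pair of adjacent vertices v, w with g v = w and g w = v, and likewise for h). Let F_g = {v : g v = v} and F_h = {v : h v = v} be their fixed-vertex sets. Assume F_g and F_h are nonempty and F_g ∩ F_h = ∅. Then the composite automorphism g∘h is hyperbolic: it fixes no vertex of T and inverts no edge of T. -/

import Mathlib

namespace SimpleGraph

variable {V : Type*} {T : SimpleGraph V}

theorem Iso.dist_apply_le (hT : T.Connected) (f : T ≃g T) (u v : V) :
    T.dist (f u) (f v) ≤ T.dist u v := by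
  obtain ⟨p, hp⟩ := hT.exists_walk_length_eq_dist u v
  rw [← hp, ← Walk.length_map f.toHom p]
  exact dist_le _

/-- An automorphism of a connected graph preserves the distance to each of its fixed vertices. -/
theorem Iso.dist_apply_of_fixed (hT : T.Connected) (f : T ≃g T) {b : V} (hb : f b = b) (v : V) :
    T.dist b (f v) = T.dist b v := by
  apply le_antisymm
  · simpa [hb] using f.dist_apply_le hT b v
  · have hb' : f.symm b = b := by rw [RelIso.symm_apply_eq, hb]
    simpa [hb'] using f.symm.dist_apply_le hT b (f v)

theorem Connected.exists_adj_dist_eq (hT : T.Connected) {v w : V} (hne : v ≠ w) :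
    ∃ x, T.Adj v x ∧ T.dist w v = T.dist w x + 1 := by
  obtain ⟨p, hp⟩ := hT.exists_walk_length_eq_dist v w
  cases p with
  | nil => exact absurd rfl hne
  | @cons _ x _ hvx q =>
    refine ⟨x, hvx, ?_⟩
    have hq := dist_le q
    have htri := hT.dist_triangle (u := v) (v := x) (w := w)
    rw [Walk.length_cons] at hp
    rw [dist_eq_one_iff_adj.mpr hvx] at htri
    rw [dist_comm, dist_comm (u := w) (v := x)]
    omega

/-- In a tree, each vertex has at most one neighbour closer to a given root. -/
theorem IsTree.eq_of_adj_of_dist_eq (hT : T.IsTree) {b x v y : V} (hv : T.Adj v x)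
    (hy : T.Adj y x) (hdv : T.dist b x = T.dist b v + 1) (hdy : T.dist b x = T.dist b y + 1) :
    v = y := by
  obtain ⟨p, hp⟩ := hT.connected.exists_walk_length_eq_dist b v
  obtain ⟨q, hq⟩ := hT.connected.exists_walk_length_eq_dist b y
  have hp' : (p.concat hv).IsPath := Walk.isPath_of_length_eq_dist _ (by simp [hp, hdv])
  have hq' : (q.concat hy).IsPath := Walk.isPath_of_length_eq_dist _ (by simp [hq, hdy])
  have heq := (hT.existsUnique_path b x).unique hp' hq'
  simpa using congrArg Walk.penultimate heq

/-- Geodesics in a tree leading away from a root keep leading away from it. -/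
theorem IsTree.dist_eq_of_adj_of_dist_eq (hT : T.IsTree) {b v x w : V} (hvx : T.Adj v x)
    (hb : T.dist b x = T.dist b v + 1) (hw : T.dist w v = T.dist w x + 1) :
    T.dist b w = T.dist b v + T.dist w v := by
  induction hn : T.dist w x generalizing v x with
  | zero =>
    obtain rfl := hT.connected.dist_eq_zero_iff.mp hn
    omega
  | succ n ih =>
    have hne : x ≠ w := by
      rintro rfl
      simp at hn
    obtain ⟨y, hxy, hy⟩ := hT.connected.exists_adj_dist_eq hne
    rcases hT.dist_eq_dist_add_one_of_adj b hxy with h | h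
    · obtain rfl := hT.eq_of_adj_of_dist_eq hvx hxy.symm hb h
      omega
    · have := ih hxy h hy (by omega)
      omega

/-- If `v` and `w` are equidistant from `b` in a tree, the geodesic from `v` to `w` starts
towards `b`. -/
theorem IsTree.dist_eq_add_one_of_equidistant (hT : T.IsTree) {b v x w : V} (hvx : T.Adj v x)
    (hw : T.dist w v = T.dist w x + 1) (hb : T.dist b v = T.dist b w) :
    T.dist b v = T.dist b x + 1 := by
  rcases hT.dist_eq_dist_add_one_of_adj b hvx with h | h
  · exact h
  · have := hT.dist_eq_of_adj_of_dist_eq hvx h hw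
    omega

/-- An automorphism of a tree with a fixed vertex that maps `v` to `w` maps the neighbour of `v`
towards `w` to the neighbour of `w` towards `v`. -/
theorem IsTree.apply_eq_of_adj (hT : T.IsTree) (f : T ≃g T) {b v w x y : V} (hb : f b = b)
    (hf : f v = w) (hvx : T.Adj v x) (hx : T.dist w v = T.dist w x + 1)
    (hwy : T.Adj w y) (hy : T.dist v w = T.dist v y + 1) : f x = y := by
  have hvw : T.dist b v = T.dist b w := by rw [← hf, f.dist_apply_of_fixed hT.connected hb]
  have hbx := hT.dist_eq_add_one_of_equidistant hvx hx hvw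
  have hby := hT.dist_eq_add_one_of_equidistant hwy hy hvw.symm
  have hadj : T.Adj (f x) w := by
    rw [← hf]
    exact f.map_adj_iff.mpr hvx.symm
  refine hT.eq_of_adj_of_dist_eq hadj hwy.symm ?_ hby
  rw [f.dist_apply_of_fixed hT.connected hb]
  omega

/-- If `h` maps `v` to `w` and `g` maps `w` back to `v`, where both automorphisms of the tree have
a fixed vertex, then they have a common fixed vertex, namely the midpoint of `v` and `w`. -/
theorem IsTree.exists_common_fixed (hT : T.IsTree) (g h : T ≃g T) {a b v w : V} (ha : g a = a)
    (hb : h b = b) (hv : h v = w) (hw : g w = v) : ∃ m, g m = m ∧ h m = m := by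
  induction hn : T.dist w v using Nat.strong_induction_on generalizing v w with
  | _ n ih =>
    by_cases hvw : v = w
    · subst hvw
      exact ⟨v, hw, hv⟩
    obtain ⟨x, hvx, hx⟩ := hT.connected.exists_adj_dist_eq hvw
    have hxw : w ≠ x := by
      rintro rfl
      have := hT.dist_ne_of_adj b hvx
      rw [← hv, h.dist_apply_of_fixed hT.connected hb] at this
      exact this rfl
    obtain ⟨y, hwy, hy⟩ := hT.connected.exists_adj_dist_eq hxw
    have hvy : T.dist v w = T.dist v y + 1 := by
      have h₁ := hT.connected.dist_triangle (u := v) (v := x) (w := y)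
      have h₂ := hT.dist_eq_dist_add_one_of_adj v hwy
      rw [dist_eq_one_iff_adj.mpr hvx] at h₁
      rw [dist_comm, dist_comm (u := w) (v := x)] at hx
      omega
    have hhx := hT.apply_eq_of_adj h hb hv hvx hx hwy hvy
    have hgy := hT.apply_eq_of_adj g ha hw hwy hvy hvx hx
    refine ih _ ?_ hhx hgy rfl
    rw [dist_comm (u := w) (v := x)] at hx
    rw [dist_comm (u := y) (v := x)]
    omega

/-- In a tree, the parity of the sum of the distances to two given vertices is constant. -/
theorem IsTree.dist_add_dist_modEq (hT : T.IsTree) (a b u v : V) :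
    T.dist a u + T.dist b u ≡ T.dist a v + T.dist b v [MOD 2] := by
  obtain ⟨p⟩ := hT.connected u v
  induction p with
  | nil => rfl
  | cons hadj _ ih =>
    refine Nat.ModEq.trans ?_ ih
    have h₁ := hT.dist_eq_dist_add_one_of_adj a hadj
    have h₂ := hT.dist_eq_dist_add_one_of_adj b hadj
    unfold Nat.ModEq
    omega

/-- The composite of two automorphisms of a tree with fixed vertices moves no vertex to a
neighbour. -/
theorem IsTree.not_adj_apply_apply (hT : T.IsTree) (g h : T ≃g T) {a b : V} (ha : g a = a)
    (hb : h b = b) (v : V) : ¬ T.Adj v (g (h v)) := by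
  intro hadj
  have h₁ := hT.dist_eq_dist_add_one_of_adj a hadj
  have h₂ := hT.dist_add_dist_modEq a b v (h v)
  rw [g.dist_apply_of_fixed hT.connected ha] at h₁
  rw [h.dist_apply_of_fixed hT.connected hb] at h₂
  unfold Nat.ModEq at h₂
  omega

end SimpleGraph

/-- If `g` and `h` are automorphisms of a tree `T`, neither inverting
an edge, with nonempty and disjoint fixed-vertex sets, then `g ∘ h` is hyperbolic:
it fixes no vertex and inverts no edge. -/
theorem stmt3 {V : Type*} (T : SimpleGraph V) (hT : T.IsTree)
    (g h : T ≃g T)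
    (hg_noinv : ¬ ∃ v w : V, T.Adj v w ∧ g v = w ∧ g w = v)
    (hh_noinv : ¬ ∃ v w : V, T.Adj v w ∧ h v = w ∧ h w = v)
    (hFg : {v : V | g v = v}.Nonempty)
    (hFh : {v : V | h v = v}.Nonempty)
    (hdisj : {v : V | g v = v} ∩ {v : V | h v = v} = ∅) :
    (∀ v : V, g (h v) ≠ v) ∧
      ¬ ∃ v w : V, T.Adj v w ∧ g (h v) = w ∧ g (h w) = v := by
  obtain ⟨a, ha⟩ := hFg
  obtain ⟨b, hb⟩ := hFh
  constructor
  · intro v hv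
    obtain ⟨m, hm⟩ := hT.exists_common_fixed g h ha hb rfl hv
    exact Set.eq_empty_iff_forall_notMem.mp hdisj m hm
  · rintro ⟨v, w, hadj, rfl, -⟩
    exact hT.not_adj_apply_apply g h ha hb v hadj
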